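/- Every 3DSMI instance of dimension 3 in which every vertex has out-degree at least one and the set of rank-1 edges forms a single directed cycle passing through all 9 vertices admits a weakly stable matching. -/

import Mathlib

/-- A 3DSMI instance of dimension `n`: a directed graph on a vertex set `V`
partitioned into three genders (men, women, dogs), each of size `n`, where every
edge goes from gender `g` to gender `g+1`, together with a rank function such that
for every vertex of out-degree `k` the ranks of its outgoing edges are exactly
`1, …, k`. -/
structure TDSMI (V : Type) [Fintype V] [DecidableEq V] (n : ℕ) where
  E : V → V → Bool
  r : V → V → ℕ
  gender : V → Fin 3
  gender_card : ∀ g : Fin 3, (Finset.univ.filter fun v => gender v = g).card = n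
  edge_gender : ∀ v w : V, E v w → gender w = gender v + 1
  rank_bij : ∀ v : V,
    (Finset.univ.filter fun w => E v w).image (r v)
      = Finset.Icc 1 (Finset.univ.filter fun w => E v w).card

namespace TDSMI

variable {V : Type} [Fintype V] [DecidableEq V] {n : ℕ}

/-- A family: a directed 3-cycle `a → b → c → a`. -/
def IsFamily (G : TDSMI V n) (a b c : V) : Prop :=
  G.E a b ∧ G.E b c ∧ G.E c a

/-- `v` is one of the vertices of the triple `t`. -/
def MemTriple (v : V) (t : V × V × V) : Prop :=
  v = t.1 ∨ v = t.2.1 ∨ v = t.2.2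

/-- A matching: a set of pairwise vertex-disjoint families. -/
def IsMatching (G : TDSMI V n) (F : Finset (V × V × V)) : Prop :=
  (∀ t ∈ F, G.IsFamily t.1 t.2.1 t.2.2) ∧
  ∀ t ∈ F, ∀ t' ∈ F, t ≠ t' → ∀ v : V, ¬ (MemTriple v t ∧ MemTriple v t')

/-- `w` is the vertex that the edge leaving `v` inside its family of `F` points to. -/
def MatchedTo (F : Finset (V × V × V)) (v w : V) : Prop :=
  ∃ t ∈ F, (t.1 = v ∧ t.2.1 = w) ∨ (t.2.1 = v ∧ t.2.2 = w) ∨ (t.2.2 = v ∧ t.1 = w)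

/-- `r(v,w) < R_F(v)`: the rank of the edge `v → w` is smaller than the rank of `v` in
the matching `F` (if `v` is in no family of `F`, its rank is `+∞` and this holds
vacuously). -/
def Prefers (G : TDSMI V n) (F : Finset (V × V × V)) (v w : V) : Prop :=
  ∀ u : V, MatchedTo F v u → G.r v w < G.r v u

/-- The directed 3-cycle `(a, b, c)` blocks the matching `F`. -/
def Blocks (G : TDSMI V n) (F : Finset (V × V × V)) (a b c : V) : Prop :=
  G.IsFamily a b c ∧ G.Prefers F a b ∧ G.Prefers F b c ∧ G.Prefers F c a

/-- A matching is weakly stable if no directed 3-cycle blocks it. -/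
def WeaklyStable (G : TDSMI V n) (F : Finset (V × V × V)) : Prop :=
  ∀ a b c : V, ¬ G.Blocks F a b c

end TDSMI

namespace TDSMI

/-! ### Preference types

Along the rank-1 cycle the vertices are numbered `0, …, 8`, so that the edge `v → w` has length
`1`, `4` or `7` modulo `9`. The preferences of a vertex are given by one of five types. -/

/-- The rank of the edge `v → w` for a vertex `v` of type `q`, or `0` if there is no such edge. -/
def typeRank (q v w : ℕ) : ℕ :=
  match (w + 9 - v) % 9, q with
  | 1, _ => 1
  | 4, 1 => 2
  | 4, 3 => 2
  | 4, 4 => 3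
  | 7, 2 => 2
  | 7, 3 => 3
  | 7, 4 => 2
  | _, _ => 0

/-- The vertices of residue `0`, `1`, `2` modulo `3` of the triple with code `t < 27`. -/
def triple (t : ℕ) : ℕ × ℕ × ℕ := (3 * (t / 9), 3 * (t / 3 % 3) + 1, 3 * (t % 3) + 2)

/-- The edges of the triple with code `t`. -/
def edges (t : ℕ) : List (ℕ × ℕ) :=
  [((triple t).1, (triple t).2.1), ((triple t).2.1, (triple t).2.2), ((triple t).2.2, (triple t).1)]

/-- A vertex of type `q` has the edge `e` and prefers it to its edge in the matching `m`. -/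
def typePrefers (m : List ℕ) (e : ℕ × ℕ) (q : ℕ) : Bool :=
  typeRank q e.1 e.2 != 0 && m.all fun t => (edges t).all fun e' =>
    e'.1 != e.1 || Nat.blt (typeRank q e.1 e.2) (typeRank q e.1 e'.2)

/-- A vertex of type `q` has the edge `e`. -/
def typeHas (e : ℕ × ℕ) (q : ℕ) : Bool := typeRank q e.1 e.2 != 0

/-- The list consists of codes of triples, no two of which share a vertex. -/
def DisjointTriples (m : List ℕ) : Bool :=
  decide ((∀ t ∈ m, t < 27) ∧
    m.Pairwise fun t t' => t / 9 ≠ t' / 9 ∧ t / 3 % 3 ≠ t' / 3 % 3 ∧ t % 3 ≠ t' % 3)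

/-- For vertices of types `σ`, the list `m` encodes a weakly stable matching. -/
def TypeStable (σ : ℕ → ℕ) (m : List ℕ) : Prop :=
  DisjointTriples m ∧ (∀ t ∈ m, ∀ e ∈ edges t, typeHas e (σ e.1)) ∧
    ∀ t < 27, ∃ e ∈ edges t, ¬ typePrefers m e (σ e.1)

/-! ### Sets of excluded types

A natural number `p` encodes the set of pairs `(v, q)` for which bit `5 * v + q` of `p` is set;
it stands for the assignments of types in which no such `v` has type `q`. -/

/-- The assignment `σ` contains no pair excluded by `p`. -/
def Avoids (σ : ℕ → ℕ) (p : ℕ) : Prop := ∀ v < 9, p.testBit (5 * v + σ v) = false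

/-- Exclude at `v` all types that violate `P`. -/
def keep (v : ℕ) (P : ℕ → Bool) : ℕ :=
  ((List.range 5).filter fun q => !P q).foldr (fun q acc => 2 ^ (5 * v + q) ||| acc) 0

/-- Exclude what is excluded by some member of the list. -/
def joinAll (l : List ℕ) : ℕ := l.foldr (· ||| ·) 0

/-- Every vertex has a type that is not excluded. The constant has the bits `5 * v` for `v < 9`. -/
def live (p : ℕ) : Bool :=
  p &&& p >>> 1 &&& p >>> 2 &&& p >>> 3 &&& p >>> 4 &&& 1134979744801 == 0

/-- The ways in which `m` can fail to be stable: an edge of `m` is missing, or all edges of `m` are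
present and some triple blocks. -/
def failures (m : List ℕ) : List ℕ :=
  ((m.flatMap edges).map fun e => keep e.1 fun q => !typeHas e q) ++
  (List.range 27).map fun t =>
    joinAll ((m.flatMap edges).map fun e => keep e.1 (typeHas e)) |||
      joinAll ((edges t).map fun e => keep e.1 (typePrefers m e))

/-- Check that every assignment of types avoiding a member of `stack` has a stable matching: the
first entry of the certificate is a matching to try on the top of the stack, which is replaced by
the ways in which this matching can fail. -/
def run : List (List ℕ) → List ℕ → Bool
  | _, [] => true
  | [], _ :: _ => false
  | m :: c, p :: stack =>
    DisjointTriples m && run c (((failures m).map (p ||| ·)).filter live ++ stack)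

theorem avoids_zero (σ : ℕ → ℕ) : Avoids σ 0 := by simp [Avoids]

theorem Avoids.or {σ : ℕ → ℕ} {p p' : ℕ} (h : Avoids σ p) (h' : Avoids σ p') :
    Avoids σ (p ||| p') := fun v hv => by simp [h v hv, h' v hv]

theorem avoids_joinAll {σ : ℕ → ℕ} {l : List ℕ} (h : ∀ p ∈ l, Avoids σ p) :
    Avoids σ (joinAll l) := by
  induction l with
  | nil => exact avoids_zero σ
  | cons p l ih =>
    exact (h p (by simp)).or (ih fun q hq => h q (by simp [hq]))

theorem avoids_keep {σ : ℕ → ℕ} (hσ : ∀ v < 9, σ v < 5) {v : ℕ} {P : ℕ → Bool} (h : P (σ v)) :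
    Avoids σ (keep v P) := by
  intro u hu
  have hl : ∀ q ∈ (List.range 5).filter fun q => !P q, q < 5 ∧ P q = false := by simp
  unfold keep
  generalize (List.range 5).filter (fun q => !P q) = l at hl
  induction l with
  | nil => simp
  | cons q l ih =>
    have hq := hl q (by simp)
    have hne : 5 * v + q ≠ 5 * u + σ u := by
      intro he
      have := hσ u hu
      obtain rfl : u = v := by omega
      obtain rfl : q = σ u := by omega
      simp [h] at hq
    simp only [List.foldr_cons, Nat.testBit_or, Nat.testBit_two_pow, Bool.or_eq_false_iff]
    exact ⟨by simpa using hne, ih fun q' hq' => hl q' (by simp [hq'])⟩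

theorem Avoids.live {σ : ℕ → ℕ} (hσ : ∀ v < 9, σ v < 5) {p : ℕ} (h : Avoids σ p) :
    live p = true := by
  by_contra hn
  obtain ⟨i, hi⟩ := Nat.exists_testBit_of_ne_zero (by simpa [TDSMI.live] using hn)
  simp only [Nat.testBit_and, Nat.testBit_shiftRight, Bool.and_eq_true] at hi
  obtain ⟨⟨⟨⟨⟨h0, h1⟩, h2⟩, h3⟩, h4⟩, hm⟩ := hi
  have hlt : i < 45 := by
    by_contra! hge
    rw [Nat.testBit_lt_two_pow (lt_of_lt_of_le (by norm_num) (Nat.pow_le_pow_right two_pos hge))]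
      at hm
    simp at hm
  have hmod : ∀ i < 45, Nat.testBit 1134979744801 i → i % 5 = 0 := by decide
  have hv : i / 5 < 9 := by omega
  have hb := h _ hv
  have hs := hσ _ hv
  have hi : 5 * (i / 5) = i := by have := hmod i hlt hm; omega
  rw [hi] at hb
  generalize σ (i / 5) = q at hb hs
  interval_cases q <;> simp_all [add_comm]

theorem exists_failure {σ : ℕ → ℕ} (hσ : ∀ v < 9, σ v < 5) {m : List ℕ} (hd : DisjointTriples m)
    (h : ¬ TypeStable σ m) : ∃ p ∈ failures m, Avoids σ p := by
  by_cases hm : ∀ e ∈ m.flatMap edges, typeHas e (σ e.1)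
  · have : ∃ t < 27, ∀ e ∈ edges t, typePrefers m e (σ e.1) := by
      by_contra! hc
      exact h ⟨hd, fun t ht e he => hm e (List.mem_flatMap.2 ⟨t, ht, he⟩), by simpa using hc⟩
    obtain ⟨t, ht, hb⟩ := this
    refine ⟨_, List.mem_append_right _ (List.mem_map.2 ⟨t, List.mem_range.2 ht, rfl⟩), ?_⟩
    refine (avoids_joinAll ?_).or (avoids_joinAll ?_)
    · rintro p hp
      obtain ⟨e, he, rfl⟩ := List.mem_map.1 hp
      exact avoids_keep hσ (hm e he)
    · rintro p hp
      obtain ⟨e, he, rfl⟩ := List.mem_map.1 hp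
      exact avoids_keep hσ (hb e he)
  · push Not at hm
    obtain ⟨e, he, hn⟩ := hm
    exact ⟨_, List.mem_append_left _ (List.mem_map.2 ⟨e, he, rfl⟩),
      avoids_keep hσ (by simpa using hn)⟩

theorem exists_typeStable_of_run {σ : ℕ → ℕ} (hσ : ∀ v < 9, σ v < 5) (c : List (List ℕ)) :
    ∀ stack : List ℕ, run c stack → ∀ p ∈ stack, Avoids σ p → ∃ m, TypeStable σ m := by
  induction c with
  | nil =>
    rintro (_ | ⟨p, stack⟩) h
    · simp
    · simp [run] at h
  | cons m c ih =>
    rintro (_ | ⟨p, stack⟩) h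
    · simp
    simp only [run, Bool.and_eq_true] at h
    intro p' hp' ha
    rcases List.mem_cons.1 hp' with rfl | hp'
    · by_contra hn
      obtain ⟨x, hx, hxa⟩ := exists_failure hσ h.1 (fun hs => hn ⟨m, hs⟩)
      refine hn (ih _ h.2 (p' ||| x) (List.mem_append_left _ ?_) (ha.or hxa))
      exact List.mem_filter.2 ⟨List.mem_map.2 ⟨x, hx, rfl⟩, (ha.or hxa).live hσ⟩
    · exact ih _ h.2 p' (List.mem_append_right _ hp') ha

/-! ### Certificates found by a computer search -/

/-- A certificate for the case in which every vertex has an edge of length `7`. -/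
def certLongAll : List (List ℕ) :=
  [[0, 13, 26]]

theorem run_certLongAll :
    run certLongAll [joinAll ((List.range 9).map fun v => keep v (typeHas (v, v + 7)))] = true := by
  decide +kernel

/-- A certificate for the case in which no vertex has an edge of length `7`. -/
def certLongNone : List (List ℕ) :=
  [[18], [4], [17], [1], [], [14], [14, 24], [24], [14, 24], [], [14], [14, 24], [24], [14, 24],
  [1, 14], [1, 14, 24], [1, 24], [1, 14, 24], [], [1], [1, 15], [1, 24], [15], [1, 15], [24], [1,
  24], [1, 17], [14], [], [15], [17], [24], [15], [], [5], [5, 15], [5, 24], [15], [5, 15], [24],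
  [5, 24], [14, 24], [4, 15], [4, 17], [4, 24], [4, 15], [1], [5], [], [14], [15], [14], [17], [],
  [4], [4, 15], [4, 17], [15], [4, 15], [17], [4, 17], [5, 15], [14], [], [15], [15, 19], [17],
  [17, 19], [19], [15, 19], [17, 19], [5], [], [15], [15, 19], [19], [15, 19], [], [15], [15, 19],
  [19], [15, 19], [5, 15], [5, 15, 19], [5, 19], [5, 15, 19], [14, 19], [1, 14], [1, 15], [1, 14],
  [1, 17], [4, 24], [4, 18], [4, 17, 18], [4, 17, 18], [5, 18], [5, 24], [5, 15, 19], [14, 18],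
  [5, 18], [4, 17, 18], [5, 24], [17, 18], [24], [1, 15], [15, 19], [15], [4, 15], [5, 15, 19],
  [14, 18], [17, 18], [4, 17, 18], [4, 17, 18]]

theorem run_certLongNone :
    run certLongNone
      [joinAll ((List.range 9).map fun v => keep v fun q => !typeHas (v, v + 7) q)] = true := by
  decide +kernel

/-- A certificate for the case in which vertex `0` has, but vertex `2` does not have, an edge
of length `7`. -/
def certLongSome : List (List ℕ) :=
  [[8, 19], [8, 9], [8, 22], [8, 13], [2], [8, 12], [8], [1, 26], [7], [1], [1, 14], [1, 14, 24],
  [1, 15], [1, 17], [1, 17], [1, 24], [1, 14, 24], [1, 17], [5, 25], [4, 15], [7, 14], [1, 14,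
  24], [1, 15], [1, 17], [1, 17], [1, 24], [1, 14, 24], [1, 17], [7, 14], [1, 14], [1, 14, 24],
  [1, 14, 24], [4, 26], [7], [4], [4, 15], [4, 17], [4, 24], [4, 15], [5, 25], [4, 15], [5, 25],
  [4, 15], [4, 15], [4, 17], [4, 24], [4, 15], [1, 12, 26], [7, 12], [1, 12], [5, 25], [4, 15],
  [4, 26], [7, 12], [4], [4, 15], [4, 17], [4, 24], [4, 15], [5, 25], [4, 15], [2, 12, 25], [2,
  12], [2, 15], [2, 12, 25], [2, 25], [2, 24], [2, 12, 25], [2, 12], [2, 12, 25], [2, 25], [2,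
  15], [1, 26], [2, 13], [1, 12], [7], [1], [1, 14], [1, 14, 24], [1, 15], [1, 17], [1, 17], [1,
  24], [1, 14, 24], [1, 17], [5, 25], [4, 15], [7, 14], [1, 14, 24], [1, 15], [1, 17], [1, 17],
  [1, 24], [1, 14, 24], [1, 17], [7, 12], [5, 25], [4, 15], [2, 13, 24], [2, 12, 25], [2, 25], [1,
  15], [1, 17], [1, 12, 26], [7, 14], [1, 14], [1, 14, 24], [1, 12, 26], [2, 25], [1, 17], [1, 14,
  24], [4, 9, 26], [8, 9, 22], [8, 13], [5, 9], [7, 9], [4, 9], [4, 11], [4, 17], [2, 15], [2,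
  15], [7, 11], [4, 17], [2, 12, 25], [2, 15], [2, 15], [5, 9, 25], [1, 12], [4, 9], [1, 17], [5,
  9, 25], [7, 9], [1, 17], [2, 12, 25], [7, 12], [5, 9, 25], [8, 13], [8, 9, 22], [1, 12], [8,
  10], [4, 9, 26], [4, 9], [1, 17], [5, 9, 25], [7, 9], [1, 17], [2, 12, 25], [1, 12, 26], [7,
  12], [5, 9, 25], [1, 12, 26], [8, 9, 22], [8, 13], [8, 22], [8, 9], [2], [8, 12], [8], [4, 26],
  [7], [4], [4, 15], [4, 17], [4, 17, 18], [4, 18], [4, 15], [4, 17, 18], [4, 24], [4, 15], [5,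
  25], [4, 15], [5, 25], [4, 15], [4, 15], [4, 17], [4, 17, 18], [4, 24], [5, 25], [7, 18], [4,
  17, 18], [4, 17, 18], [4, 24], [4, 15], [8, 18], [4, 26], [4, 24], [4, 18], [4, 17, 18], [5,
  25], [7, 18], [4, 17, 18], [4, 17, 18], [4, 26], [7, 12], [4], [4, 15], [4, 17], [4, 17, 18],
  [4, 18], [4, 15], [4, 17, 18], [4, 24], [4, 15], [5, 25], [4, 15], [2, 12, 25], [2, 12], [2,
  15], [2, 12, 25], [2, 25], [2, 12], [8, 18], [2, 24], [2, 25], [4, 20], [4, 18], [4, 17, 18],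
  [4, 17, 18], [2, 12, 25], [2, 12], [2, 24], [2, 12, 25], [2, 12, 25], [2, 25], [2, 15], [4, 9,
  26], [5, 9], [7, 9], [4, 9], [4, 15], [4, 11], [4, 17], [4, 17, 18], [4, 17, 18], [2, 15], [7,
  11], [4, 17], [4, 17, 18], [2, 12, 25], [2, 15], [4, 17, 18], [2, 15], [5, 9, 25], [8, 9, 22],
  [8, 9, 22], [8, 21], [8, 18], [4, 24], [4, 26], [4, 18], [4, 17, 18], [5, 25], [7, 18], [4, 17,
  18], [2, 25], [4, 20], [4, 17, 18], [2, 24], [4, 17, 18], [2, 21], [4, 26], [4, 24], [4, 18],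
  [4, 17, 18], [7, 21], [5, 25], [5, 25], [4, 17, 18], [4, 17, 18], [2, 15, 22], [2, 12, 25], [8,
  13, 18], [8, 9, 22], [8, 12, 19], [8, 10], [8, 9], [4, 9, 26], [7, 9], [4, 9], [1, 17], [4, 17,
  18], [5, 9, 25], [5, 9, 25], [1, 17], [4, 17, 18], [4, 9, 26], [8, 13, 18], [4, 9], [1, 17], [5,
  9, 25], [7, 9], [1, 17], [8, 13, 18], [8, 12, 19], [8, 12, 19]]

theorem run_certLongSome :
    run certLongSome [keep 0 (typeHas (0, 7)) ||| keep 2 fun q => !typeHas (2, 9) q] = true := by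
  decide +kernel

/-! ### From instances to types -/

/-- The set of families encoded by a list of triples. -/
def familiesOf {V : Type} [DecidableEq V] (g : ℕ → V) (m : List ℕ) :
    Finset (V × V × V) :=
  (m.map fun t => (g (triple t).1, g (triple t).2.1, g (triple t).2.2)).toFinset

theorem mem_familiesOf {V : Type} [DecidableEq V] {g : ℕ → V} {m : List ℕ} {x : V × V × V} :
    x ∈ familiesOf g m ↔ ∃ t ∈ m, (g (triple t).1, g (triple t).2.1, g (triple t).2.2) = x := by
  simp [familiesOf]

theorem matchedTo_of_mem_edges {V : Type} [DecidableEq V] (g : ℕ → V) {m : List ℕ} {t : ℕ}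
    (ht : t ∈ m) {e : ℕ × ℕ} (he : e ∈ edges t) : MatchedTo (familiesOf g m) (g e.1) (g e.2) := by
  refine ⟨_, mem_familiesOf.2 ⟨t, ht, rfl⟩, ?_⟩
  simp only [edges, List.mem_cons, List.not_mem_nil, or_false] at he
  rcases he with rfl | rfl | rfl <;> simp

variable {V : Type} [Fintype V] [DecidableEq V]

section

variable {α : Type*} [DecidableEq α] {S : Finset α} {r : α → ℕ} {x y z : α}

theorem rank_eq_two_of_pair (h : S.image r = Finset.Icc 1 S.card) (hxy : x ≠ y) (hx : x ∈ S)
    (hy : y ∈ S) (hr : r x = 1) (hS : ∀ a ∈ S, a = x ∨ a = y) : r y = 2 := by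
  obtain rfl : S = {x, y} := by
    ext a
    simp only [Finset.mem_insert, Finset.mem_singleton]
    exact ⟨hS a, by rintro (rfl | rfl) <;> assumption⟩
  rw [Finset.card_pair hxy] at h
  have h2 : 2 ∈ Finset.Icc 1 2 := by decide
  simp only [← h, Finset.mem_image, Finset.mem_insert, Finset.mem_singleton, exists_eq_or_imp,
    exists_eq_left, hr] at h2
  omega

theorem rank_of_triple (h : S.image r = Finset.Icc 1 S.card) (hxy : x ≠ y) (hxz : x ≠ z)
    (hyz : y ≠ z) (hx : x ∈ S) (hy : y ∈ S) (hz : z ∈ S) (hr : r x = 1)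
    (hS : ∀ a ∈ S, a = x ∨ a = y ∨ a = z) : r y = 2 ∧ r z = 3 ∨ r y = 3 ∧ r z = 2 := by
  obtain rfl : S = {x, y, z} := by
    ext a
    simp only [Finset.mem_insert, Finset.mem_singleton]
    exact ⟨hS a, by rintro (rfl | rfl | rfl) <;> assumption⟩
  rw [Finset.card_eq_three.2 ⟨x, y, z, hxy, hxz, hyz, rfl⟩] at h
  have h2 : 2 ∈ Finset.Icc 1 3 := by decide
  have h3 : 3 ∈ Finset.Icc 1 3 := by decide
  simp only [← h, Finset.mem_image, Finset.mem_insert, Finset.mem_singleton, exists_eq_or_imp,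
    exists_eq_left, hr] at h2 h3
  omega

theorem rank_cases (h : S.image r = Finset.Icc 1 S.card) (hxy : x ≠ y) (hxz : x ≠ z)
    (hyz : y ≠ z) (hx : x ∈ S) (hr : r x = 1) (hS : ∀ a ∈ S, a = x ∨ a = y ∨ a = z) :
    (y ∉ S ∧ z ∉ S) ∨ (y ∈ S ∧ z ∉ S ∧ r y = 2) ∨ (y ∉ S ∧ z ∈ S ∧ r z = 2) ∨
      (y ∈ S ∧ z ∈ S ∧ (r y = 2 ∧ r z = 3 ∨ r y = 3 ∧ r z = 2)) := by
  by_cases hy : y ∈ S <;> by_cases hz : z ∈ S <;>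
    simp only [hy, hz, not_true, not_false_eq_true, true_and, false_and, or_false, false_or]
  · exact rank_of_triple h hxy hxz hyz hx hy hz hr hS
  · refine rank_eq_two_of_pair h hxy hx hy hr fun a ha => ?_
    rcases hS a ha with rfl | rfl | rfl <;> simp_all
  · refine rank_eq_two_of_pair h hxz hx hz hr fun a ha => ?_
    rcases hS a ha with rfl | rfl | rfl <;> simp_all

end

/-- The vertices of `G` are listed periodically by `g` along a cycle of rank-1 edges. -/
structure IsTopCycle (G : TDSMI V 3) (g : ℕ → V) : Prop where
  periodic : ∀ i, g (i + 9) = g i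
  inj : ∀ i < 9, ∀ j < 9, g i = g j → i = j
  surj : ∀ x, ∃ i < 9, g i = x
  edge : ∀ i, G.E (g i) (g (i + 1))
  rank : ∀ i, G.r (g i) (g (i + 1)) = 1

/-- The vertex `g v` has type `q`. -/
def HasType (G : TDSMI V 3) (g : ℕ → V) (v q : ℕ) : Prop :=
  ∀ w < 9, w % 3 = (v + 1) % 3 → (G.E (g v) (g w) ↔ typeRank q v w ≠ 0) ∧
    (G.E (g v) (g w) → G.r (g v) (g w) = typeRank q v w)

namespace IsTopCycle

variable {G : TDSMI V 3} {g : ℕ → V}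

theorem shift (hg : IsTopCycle G g) (k : ℕ) : IsTopCycle G fun i => g (i + k) := by
  have hp : Function.Periodic g 9 := hg.periodic
  have hmod : ∀ i, g (i % 9) = g i := hp.map_mod_nat
  refine ⟨fun i => ?_, fun i hi j hj h => ?_, fun x => ?_, fun i => ?_, fun i => ?_⟩
  · rw [show i + 9 + k = i + k + 9 by omega, hg.periodic]
  · rw [← hmod (i + k), ← hmod (j + k)] at h
    have := hg.inj _ (Nat.mod_lt _ (by omega)) _ (Nat.mod_lt _ (by omega)) h
    omega
  · obtain ⟨i, hi, rfl⟩ := hg.surj x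
    refine ⟨(i + 9 - k % 9) % 9, Nat.mod_lt _ (by omega), ?_⟩
    rw [← hmod, ← hmod i]
    congr 1
    omega
  · rw [show i + 1 + k = i + k + 1 by omega]
    exact hg.edge _
  · rw [show i + 1 + k = i + k + 1 by omega]
    exact hg.rank _

theorem gender_eq (hg : IsTopCycle G g) (i : ℕ) :
    (G.gender (g i)).val = ((G.gender (g 0)).val + i) % 3 := by
  induction i with
  | zero => have := (G.gender (g 0)).isLt; omega
  | succ i ih =>
    rw [G.edge_gender _ _ (hg.edge i), Fin.val_add, ih]
    simp only [Fin.val_one]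
    omega

theorem mod_of_edge (hg : IsTopCycle G g) {v w : ℕ} (h : G.E (g v) (g w)) :
    w % 3 = (v + 1) % 3 := by
  have h1 := congrArg Fin.val (G.edge_gender _ _ h)
  rw [Fin.val_add, hg.gender_eq v, hg.gender_eq w] at h1
  simp only [Fin.val_one] at h1
  omega

theorem add_inj (hg : IsTopCycle G g) (v : ℕ) {i j : ℕ} (hi : i < 9) (hj : j < 9)
    (h : g (v + i) = g (v + j)) : i = j :=
  (hg.shift v).inj i hi j hj (by simpa only [add_comm] using h)

theorem eq_of_edge (hg : IsTopCycle G g) {v : ℕ} {x : V} (h : G.E (g v) x) :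
    x = g (v + 1) ∨ x = g (v + 4) ∨ x = g (v + 7) := by
  obtain ⟨d, hd, rfl⟩ := (hg.shift v).surj x
  have := hg.mod_of_edge h
  have : d = 1 ∨ d = 4 ∨ d = 7 := by omega
  rcases this with rfl | rfl | rfl <;> simp [add_comm]

theorem exists_rank (hg : IsTopCycle G g) (v : ℕ) : ∃ q < 5, ∀ d, d = 1 ∨ d = 4 ∨ d = 7 →
    (G.E (g v) (g (v + d)) ↔ typeRank q 0 d ≠ 0) ∧
      (G.E (g v) (g (v + d)) → G.r (g v) (g (v + d)) = typeRank q 0 d) := by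
  have h1 := hg.edge v
  have hr := hg.rank v
  have h14 : g (v + 1) ≠ g (v + 4) := fun h => by simpa using hg.add_inj v (by omega) (by omega) h
  have h17 : g (v + 1) ≠ g (v + 7) := fun h => by simpa using hg.add_inj v (by omega) (by omega) h
  have h47 : g (v + 4) ≠ g (v + 7) := fun h => by simpa using hg.add_inj v (by omega) (by omega) h
  have hcases := rank_cases (G.rank_bij (g v)) h14 h17 h47 (by simpa using h1) hr
    fun x hx => hg.eq_of_edge (by simpa using hx)
  simp only [Finset.mem_filter_univ] at hcases
  rcases hcases with ⟨h4, h7⟩ | ⟨h4, h7, hr4⟩ | ⟨h4, h7, hr7⟩ |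
    ⟨h4, h7, ⟨hr4, hr7⟩ | ⟨hr4, hr7⟩⟩
  · refine ⟨0, by omega, ?_⟩
    rintro d (rfl | rfl | rfl) <;> simp [typeRank, *]
  · refine ⟨1, by omega, ?_⟩
    rintro d (rfl | rfl | rfl) <;> simp [typeRank, *]
  · refine ⟨2, by omega, ?_⟩
    rintro d (rfl | rfl | rfl) <;> simp [typeRank, *]
  · refine ⟨3, by omega, ?_⟩
    rintro d (rfl | rfl | rfl) <;> simp [typeRank, *]
  · refine ⟨4, by omega, ?_⟩
    rintro d (rfl | rfl | rfl) <;> simp [typeRank, *]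

theorem exists_hasType (hg : IsTopCycle G g) {v : ℕ} (hv : v < 9) : ∃ q < 5, HasType G g v q := by
  obtain ⟨q, hq, h⟩ := hg.exists_rank v
  refine ⟨q, hq, fun w hw hmod => ?_⟩
  have hd := h ((w + 9 - v) % 9) (by omega)
  have hgw : g (v + (w + 9 - v) % 9) = g w := by
    have hp : Function.Periodic g 9 := hg.periodic
    rw [← hp.map_mod_nat, ← hp.map_mod_nat w]
    congr 1
    omega
  have hr : typeRank q 0 ((w + 9 - v) % 9) = typeRank q v w := by
    unfold typeRank
    rw [show ((w + 9 - v) % 9 + 9 - 0) % 9 = (w + 9 - v) % 9 by omega]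
  rwa [hgw, hr] at hd

theorem exists_types (hg : IsTopCycle G g) :
    ∃ σ : ℕ → ℕ, (∀ v < 9, σ v < 5) ∧ ∀ v < 9, HasType G g v (σ v) := by
  have : ∀ v, ∃ q, v < 9 → q < 5 ∧ HasType G g v q := fun v => by
    by_cases hv : v < 9
    · obtain ⟨q, hq⟩ := hg.exists_hasType hv
      exact ⟨q, fun _ => hq⟩
    · exact ⟨0, fun h => absurd h hv⟩
  choose σ hσ using this
  exact ⟨σ, fun v hv => (hσ v hv).1, fun v hv => (hσ v hv).2⟩

end IsTopCycle

theorem edges_spec {t : ℕ} (ht : t < 27) {e : ℕ × ℕ} (he : e ∈ edges t) :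
    e.1 < 9 ∧ e.2 < 9 ∧ e.2 % 3 = (e.1 + 1) % 3 := by
  simp only [edges, triple, List.mem_cons, List.not_mem_nil, or_false] at he
  rcases he with rfl | rfl | rfl <;> dsimp only <;> omega

theorem Blocks.rotate {G : TDSMI V 3} {F : Finset (V × V × V)} {a b c : V}
    (h : G.Blocks F a b c) : G.Blocks F b c a :=
  ⟨⟨h.1.2.1, h.1.2.2, h.1.1⟩, h.2.2.1, h.2.2.2, h.2.1⟩

section

variable {G : TDSMI V 3} {g : ℕ → V} {σ : ℕ → ℕ} {m : List ℕ}

theorem TypeStable.lt (hm : TypeStable σ m) {t : ℕ} (ht : t ∈ m) : t < 27 := by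
  have := hm.1
  simp only [DisjointTriples, decide_eq_true_eq] at this
  exact this.1 t ht

theorem TypeStable.edge (hσ : ∀ v < 9, HasType G g v (σ v)) (hm : TypeStable σ m) {t : ℕ}
    (ht : t ∈ m) {e : ℕ × ℕ} (he : e ∈ edges t) : G.E (g e.1) (g e.2) := by
  obtain ⟨h1, h2, h3⟩ := edges_spec (hm.lt ht) he
  exact ((hσ _ h1 _ h2 h3).1).2 (by simpa [typeHas] using hm.2.1 t ht e he)

theorem TypeStable.typePrefers (hσ : ∀ v < 9, HasType G g v (σ v)) (hm : TypeStable σ m)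
    {e : ℕ × ℕ} (h1 : e.1 < 9) (h2 : e.2 < 9) (h3 : e.2 % 3 = (e.1 + 1) % 3)
    (hE : G.E (g e.1) (g e.2)) (hp : G.Prefers (familiesOf g m) (g e.1) (g e.2)) :
    TDSMI.typePrefers m e (σ e.1) := by
  obtain ⟨hiff, hr⟩ := hσ _ h1 _ h2 h3
  simp only [TDSMI.typePrefers, Bool.and_eq_true, bne_iff_ne, List.all_eq_true, Bool.or_eq_true,
    Nat.blt_eq]
  refine ⟨hiff.1 hE, fun t ht e' he' => ?_⟩
  by_cases heq : e'.1 = e.1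
  · right
    obtain ⟨h1', h2', h3'⟩ := edges_spec (hm.lt ht) he'
    have hE' := hm.edge hσ ht he'
    have hlt := hp _ (heq ▸ matchedTo_of_mem_edges g ht he')
    rw [heq] at h3' hE'
    rwa [hr hE, (hσ _ h1 _ h2' h3').2 hE'] at hlt
  · exact Or.inl heq

theorem TypeStable.isMatching (hg : IsTopCycle G g) (hσ : ∀ v < 9, HasType G g v (σ v))
    (hm : TypeStable σ m) : G.IsMatching (familiesOf g m) := by
  constructor
  · intro x hx
    obtain ⟨t, ht, rfl⟩ := mem_familiesOf.1 hx
    exact ⟨hm.edge hσ ht (e := ((triple t).1, (triple t).2.1)) (by simp [edges]),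
      hm.edge hσ ht (e := ((triple t).2.1, (triple t).2.2)) (by simp [edges]),
      hm.edge hσ ht (e := ((triple t).2.2, (triple t).1)) (by simp [edges])⟩
  · intro x hx x' hx' hne v ⟨hv, hv'⟩
    obtain ⟨t, ht, rfl⟩ := mem_familiesOf.1 hx
    obtain ⟨t', ht', rfl⟩ := mem_familiesOf.1 hx'
    have htt : t ≠ t' := fun h => hne (by rw [h])
    have hlt := hm.lt ht
    have hlt' := hm.lt ht'
    have hpw := hm.1
    simp only [DisjointTriples, decide_eq_true_eq] at hpw
    have : Std.Symm fun t t' : ℕ => t / 9 ≠ t' / 9 ∧ t / 3 % 3 ≠ t' / 3 % 3 ∧ t % 3 ≠ t' % 3 :=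
      ⟨fun _ _ h => ⟨h.1.symm, h.2.1.symm, h.2.2.symm⟩⟩
    have hd := hpw.2.forall ht ht' htt
    simp only [MemTriple, triple] at hv hv'
    rcases hv with rfl | rfl | rfl <;> rcases hv' with h | h | h <;>
    · have := hg.inj _ (by omega) _ (by omega) h
      omega

theorem TypeStable.not_blocks (hσ : ∀ v < 9, HasType G g v (σ v)) (hm : TypeStable σ m)
    {i j k : ℕ} (hi : i < 9) (hj : j < 9) (hk : k < 9) (hi0 : i % 3 = 0) (hj1 : j % 3 = 1)
    (hk2 : k % 3 = 2) : ¬ G.Blocks (familiesOf g m) (g i) (g j) (g k) := by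
  rintro ⟨⟨hij, hjk, hki⟩, pij, pjk, pki⟩
  obtain ⟨e, he, hn⟩ := hm.2.2 (9 * (i / 3) + 3 * (j / 3) + k / 3) (by omega)
  have htr : triple (9 * (i / 3) + 3 * (j / 3) + k / 3) = (i, j, k) := by
    simp only [triple, Prod.mk.injEq]
    omega
  simp only [edges, htr, List.mem_cons, List.not_mem_nil, or_false] at he
  rcases he with rfl | rfl | rfl
  · exact hn (hm.typePrefers hσ hi hj (by dsimp only; omega) hij pij)
  · exact hn (hm.typePrefers hσ hj hk (by dsimp only; omega) hjk pjk)
  · exact hn (hm.typePrefers hσ hk hi (by dsimp only; omega) hki pki)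

theorem TypeStable.weaklyStable (hg : IsTopCycle G g) (hσ : ∀ v < 9, HasType G g v (σ v))
    (hm : TypeStable σ m) : G.WeaklyStable (familiesOf g m) := by
  intro a b c h
  obtain ⟨i, hi, rfl⟩ := hg.surj a
  obtain ⟨j, hj, rfl⟩ := hg.surj b
  obtain ⟨k, hk, rfl⟩ := hg.surj c
  have hij := hg.mod_of_edge h.1.1
  have hjk := hg.mod_of_edge h.1.2.1
  have : i % 3 = 0 ∨ i % 3 = 1 ∨ i % 3 = 2 := by omega
  rcases this with h0 | h1 | h2
  · exact hm.not_blocks hσ hi hj hk (by omega) (by omega) (by omega) h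
  · exact hm.not_blocks hσ hk hi hj (by omega) (by omega) (by omega) h.rotate.rotate
  · exact hm.not_blocks hσ hj hk hi (by omega) (by omega) (by omega) h.rotate

theorem IsTopCycle.exists_weaklyStable_of_run (hg : IsTopCycle G g)
    (hσ : ∀ v < 9, HasType G g v (σ v)) (hσ5 : ∀ v < 9, σ v < 5) {c : List (List ℕ)} {p : ℕ}
    (hc : run c [p]) (hp : Avoids σ p) :
    ∃ F : Finset (V × V × V), G.IsMatching F ∧ G.WeaklyStable F := by
  obtain ⟨m, hm⟩ := exists_typeStable_of_run hσ5 c [p] hc p (by simp) hp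
  exact ⟨_, hm.isMatching hg hσ, hm.weaklyStable hg hσ⟩

end

theorem typeHas_long_iff {G : TDSMI V 3} {g : ℕ → V} (hg : IsTopCycle G g) {v q : ℕ} (hv : v < 9)
    (h : HasType G g v q) : typeHas (v, v + 7) q = true ↔ G.E (g v) (g (v + 7)) := by
  have h7 := (h ((v + 7) % 9) (by omega) (by omega)).1
  rw [(show Function.Periodic g 9 from hg.periodic).map_mod_nat] at h7
  have hr : typeRank q v ((v + 7) % 9) = typeRank q v (v + 7) := by
    unfold typeRank
    rw [show ((v + 7) % 9 + 9 - v) % 9 = (v + 7 + 9 - v) % 9 by omega]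
  rw [h7, hr]
  simp [typeHas]

theorem IsTopCycle.exists_weaklyStable {G : TDSMI V 3} {g : ℕ → V} (hg : IsTopCycle G g) :
    ∃ F : Finset (V × V × V), G.IsMatching F ∧ G.WeaklyStable F := by
  by_cases hall : ∀ i, G.E (g i) (g (i + 7))
  · obtain ⟨σ, hσ5, hσ⟩ := hg.exists_types
    refine hg.exists_weaklyStable_of_run hσ hσ5 run_certLongAll (avoids_joinAll fun p hp => ?_)
    obtain ⟨v, hv, rfl⟩ := List.mem_map.1 hp
    have hv := List.mem_range.1 hv
    exact avoids_keep hσ5 ((typeHas_long_iff hg hv (hσ v hv)).2 (hall v))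
  by_cases hnone : ∀ i, ¬ G.E (g i) (g (i + 7))
  · obtain ⟨σ, hσ5, hσ⟩ := hg.exists_types
    refine hg.exists_weaklyStable_of_run hσ hσ5 run_certLongNone (avoids_joinAll fun p hp => ?_)
    obtain ⟨v, hv, rfl⟩ := List.mem_map.1 hp
    have hv := List.mem_range.1 hv
    refine avoids_keep hσ5 ?_
    rw [Bool.not_eq_true', ← Bool.not_eq_true, typeHas_long_iff hg hv (hσ v hv)]
    exact hnone v
  obtain ⟨k, hk, hk2⟩ : ∃ k, G.E (g k) (g (k + 7)) ∧ ¬ G.E (g (k + 2)) (g (k + 2 + 7)) := by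
    by_contra! hstep
    push Not at hall hnone
    obtain ⟨i, hi⟩ := hnone
    obtain ⟨j, hj⟩ := hall
    have hn : ∀ n, G.E (g (i + 2 * n)) (g (i + 2 * n + 7)) := fun n => by
      induction n with
      | zero => exact hi
      | succ n ih => exact hstep _ ih
    have hp : Function.Periodic g 9 := hg.periodic
    have h := hn (5 * (j + 8 * i))
    rw [← hp.map_mod_nat, ← hp.map_mod_nat (_ + 7),
      show (i + 2 * (5 * (j + 8 * i))) % 9 = j % 9 by omega,
      show (i + 2 * (5 * (j + 8 * i)) + 7) % 9 = (j + 7) % 9 by omega,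
      hp.map_mod_nat, hp.map_mod_nat] at h
    exact hj h
  have hs := hg.shift k
  obtain ⟨σ, hσ5, hσ⟩ := hs.exists_types
  refine hs.exists_weaklyStable_of_run hσ hσ5 run_certLongSome ((avoids_keep hσ5 ?_).or
    (avoids_keep hσ5 ?_))
  · rw [typeHas_long_iff hs (v := 0) (by omega) (hσ 0 (by omega))]
    simpa [add_comm] using hk
  · rw [Bool.not_eq_true', ← Bool.not_eq_true, typeHas_long_iff hs (v := 2) (by omega)
      (hσ 2 (by omega))]
    rwa [show 2 + k = k + 2 by omega, show 2 + 7 + k = k + 2 + 7 by omega]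

end TDSMI

/-- Every 3DSMI instance of dimension 3 in which every vertex has out-degree at least one
and the rank-1 edges form a single directed cycle through all 9 vertices admits a weakly
stable matching. -/
theorem stmt_18 {V : Type} [Fintype V] [DecidableEq V] (G : TDSMI V 3)
    (hdeg : ∀ v : V, ∃ w : V, G.E v w)
    (hcyc : ∃ f : ZMod 9 → V, Function.Bijective f ∧
      ∀ i : ZMod 9, G.E (f i) (f (i + 1)) ∧ G.r (f i) (f (i + 1)) = 1) :
    ∃ F : Finset (V × V × V), G.IsMatching F ∧ G.WeaklyStable F := by
  obtain ⟨f, hf, hr⟩ := hcyc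
  have hg : TDSMI.IsTopCycle G fun i => f (i : ZMod 9) := by
    refine ⟨fun i => ?_, fun i hi j hj h => ?_, fun x => ?_, fun i => ?_, fun i => ?_⟩
    · rw [Nat.cast_add, show ((9 : ℕ) : ZMod 9) = 0 from rfl, add_zero]
    · have := (ZMod.natCast_eq_natCast_iff' i j 9).1 (hf.1 h)
      omega
    · obtain ⟨i, rfl⟩ := hf.2 x
      exact ⟨i.val, ZMod.val_lt i, by rw [ZMod.natCast_zmod_val]⟩
    · simpa using (hr i).1
    · simpa using (hr i).2
  exact hg.exists_weaklyStable
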